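/- Let {c_n}_{n≥1} be real and {d_{n+1}}_{n≥1} positive reals. Let R_n be the complex polynomials defined by R_{−1} ≡ 0, R_0 ≡ 1 and R_{n+1}(z) = [(1+ic_{n+1})z + (1−ic_{n+1})] R_n(z) − 4 d_{n+1} z R_{n−1}(z) for n ≥ 0, and let W_n : [−1,1] → ℝ be defined by W_{−1} ≡ 0, W_0 ≡ 1 and W_{n+1}(x) = (x − c_{n+1}√(1−x²)) W_n(x) − d_{n+1} W_{n−1}(x) for n ≥ 0. Then for every n ≥ 0 and every θ ∈ [0, 2π], R_n(e^{iθ}) = 2ⁿ e^{inθ/2} W_n(cos(θ/2)). -/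

import Mathlib

noncomputable section

/-- The functions `W n`, where `W c d n x` is `W_n(x)`: `W_0 = 1`, `W_1(x) = x - c_1*sqrt(1-x^2)`,
`W_{n+1}(x) = (x - c_{n+1}*sqrt(1-x^2)) W_n(x) - d_{n+1} W_{n-1}(x)`. -/
def W (c d : ℕ → ℝ) : ℕ → ℝ → ℝ
  | 0, _ => 1
  | 1, x => x - c 1 * Real.sqrt (1 - x ^ 2)
  | n + 2, x =>
      (x - c (n + 2) * Real.sqrt (1 - x ^ 2)) * W c d (n + 1) x - d (n + 2) * W c d n x

/-- The para-orthogonal polynomials `R_n`: `R_0 = 1` and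
`R_{n+1}(z) = [(1+ic_{n+1})z + (1-ic_{n+1})] R_n(z) - 4 d_{n+1} z R_{n-1}(z)` with `R_{-1} = 0`. -/
def Rpoly (c d : ℕ → ℝ) : ℕ → Polynomial ℂ
  | 0 => 1
  | 1 => Polynomial.C (1 + Complex.I * ((c 1 : ℝ) : ℂ)) * Polynomial.X +
      Polynomial.C (1 - Complex.I * ((c 1 : ℝ) : ℂ))
  | n + 2 =>
      (Polynomial.C (1 + Complex.I * ((c (n + 2) : ℝ) : ℂ)) * Polynomial.X +
        Polynomial.C (1 - Complex.I * ((c (n + 2) : ℝ) : ℂ))) * Rpoly c d (n + 1) -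
      Polynomial.C ((4 * d (n + 2) : ℝ) : ℂ) * Polynomial.X * Rpoly c d n

/-- At `z = e^{iθ}` the linear factor of the recurrence for `Rpoly` becomes
`2 e^{iθ/2} (cos (θ/2) - t sin (θ/2))`. -/
theorem linear_factor_exp (t θ : ℝ) :
    (1 + Complex.I * (t : ℂ)) * Complex.exp (Complex.I * ((θ / 2 : ℝ) : ℂ)) ^ 2 +
        (1 - Complex.I * (t : ℂ)) =
      2 * Complex.exp (Complex.I * ((θ / 2 : ℝ) : ℂ)) *
        ((Real.cos (θ / 2) - t * Real.sin (θ / 2) : ℝ) : ℂ) := by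
  have hw : Complex.exp (Complex.I * ((θ / 2 : ℝ) : ℂ)) =
      (Real.cos (θ / 2) : ℂ) + Complex.I * (Real.sin (θ / 2) : ℂ) := by
    rw [mul_comm, Complex.exp_mul_I, Complex.ofReal_cos, Complex.ofReal_sin]
    ring
  have hcs : (Real.sin (θ / 2) : ℂ) ^ 2 + (Real.cos (θ / 2) : ℂ) ^ 2 = 1 := by
    exact_mod_cast Real.sin_sq_add_cos_sq (θ / 2)
  rw [hw, Complex.ofReal_sub, Complex.ofReal_mul]
  generalize (Real.cos (θ / 2) : ℂ) = x at *
  generalize (Real.sin (θ / 2) : ℂ) = y at *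
  linear_combination (Complex.I * t - 1) * hcs +
    (y ^ 2 * (1 + Complex.I * t) + 2 * t * x * y) * Complex.I_sq

/-- On `[0, 2π]` the square root in the recurrence for `W` is `sin (θ/2)`. -/
theorem sqrt_one_sub_cos_half_sq {θ : ℝ} (hθ : θ ∈ Set.Icc (0 : ℝ) (2 * Real.pi)) :
    Real.sqrt (1 - Real.cos (θ / 2) ^ 2) = Real.sin (θ / 2) := by
  rw [← Real.sin_sq, Real.sqrt_sq]
  exact Real.sin_nonneg_of_nonneg_of_le_pi (by linarith [hθ.1]) (by linarith [hθ.2])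

/-- The Delsarte–Genin relation, with `e^{inθ/2}` written as a power of `e^{iθ/2}`. -/
theorem Rpoly_eval_exp_half_sq (c d : ℕ → ℝ) {θ : ℝ}
    (hθ : θ ∈ Set.Icc (0 : ℝ) (2 * Real.pi)) (n : ℕ) :
    (Rpoly c d n).eval (Complex.exp (Complex.I * ((θ / 2 : ℝ) : ℂ)) ^ 2) =
      2 ^ n * Complex.exp (Complex.I * ((θ / 2 : ℝ) : ℂ)) ^ n *
        ((W c d n (Real.cos (θ / 2)) : ℝ) : ℂ) := by
  induction n using Nat.twoStepInduction with
  | zero => simp [Rpoly, W]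
  | one =>
    simp only [Rpoly, W, sqrt_one_sub_cos_half_sq hθ, Polynomial.eval_add, Polynomial.eval_mul,
      Polynomial.eval_C, Polynomial.eval_X, pow_one]
    exact linear_factor_exp (c 1) θ
  | more n ih ih' =>
    simp only [Rpoly, W, sqrt_one_sub_cos_half_sq hθ, Polynomial.eval_sub, Polynomial.eval_add,
      Polynomial.eval_mul, Polynomial.eval_C, Polynomial.eval_X]
    rw [linear_factor_exp (c (n + 2)) θ, ih, ih']
    push_cast
    ring

theorem stmt19 (c d : ℕ → ℝ) (hd : ∀ n, 1 ≤ n → 0 < d (n + 1)) :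
    ∀ (n : ℕ) (θ : ℝ), θ ∈ Set.Icc (0 : ℝ) (2 * Real.pi) →
      (Rpoly c d n).eval (Complex.exp (Complex.I * (θ : ℂ))) =
        2 ^ n * Complex.exp (Complex.I * ((n * θ / 2 : ℝ) : ℂ)) *
          ((W c d n (Real.cos (θ / 2)) : ℝ) : ℂ) := by
  intro n θ hθ
  have hz : Complex.exp (Complex.I * (θ : ℂ)) =
      Complex.exp (Complex.I * ((θ / 2 : ℝ) : ℂ)) ^ 2 := by
    rw [← Complex.exp_nat_mul]
    push_cast
    ring_nf
  have hn : Complex.exp (Complex.I * ((n * θ / 2 : ℝ) : ℂ)) =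
      Complex.exp (Complex.I * ((θ / 2 : ℝ) : ℂ)) ^ n := by
    rw [← Complex.exp_nat_mul]
    push_cast
    ring_nf
  rw [hz, hn]
  exact Rpoly_eval_exp_half_sq c d hθ n
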